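/- Under the constraints 0 ≤ ξ_r^2 < η_r (r = 1,2), 0 < α_1, α_2 < 1, α_1 + α_2 = 1, the function f(t) = Σ_{r=1}^2 α_r Q_r'(t) log(Q_r(t)/(α_1 Q_1(t) + α_2 Q_2(t))), with Q_r(t) = t^2 + 2t ξ_r + η_r, has at most two real roots, provided (ξ_1, η_1) ≠ (ξ_2, η_2). -/

import Mathlib

open Real Set

namespace QubitRoots

/-- The monic quadratic `s² + 2xs + 1`, which is its own reciprocal polynomial. -/
noncomputable def quad (x s : ℝ) : ℝ := s ^ 2 + 2 * s * x + 1

/-- The basic summand `(1 + xs) log (s² + 2xs + 1)`. -/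
noncomputable def logTerm (x s : ℝ) : ℝ := (1 + x * s) * log (quad x s)

/-- The derivative of `logTerm x`. -/
noncomputable def logTermDeriv (x s : ℝ) : ℝ :=
  x * log (quad x s) + (1 + x * s) * ((2 * s + 2 * x) / quad x s)

/-- The second derivative of `logTerm x`. -/
noncomputable def logTermDeriv2 (x s : ℝ) : ℝ :=
  2 * x * ((2 * s + 2 * x) / quad x s)
    + (1 + x * s) * ((2 * quad x s - (2 * s + 2 * x) ^ 2) / quad x s ^ 2)

/-- The relativistic sum of `x` and `2s / (1 + s²)`. -/
noncomputable def velocitySum (x s : ℝ) : ℝ := (x * (1 + s ^ 2) + 2 * s) / quad x s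

lemma quad_pos {x : ℝ} (hx : x ^ 2 < 1) (s : ℝ) : 0 < quad x s := by
  unfold quad
  nlinarith [sq_nonneg (s + x)]

lemma hasDerivAt_quad (x s : ℝ) : HasDerivAt (quad x) (2 * s + 2 * x) s := by
  have h := (((hasDerivAt_id s).pow 2).add
    (((hasDerivAt_id s).const_mul 2).mul_const x)).add_const 1
  exact h.congr_deriv (by simp)

lemma hasDerivAt_logTerm {x : ℝ} (hx : x ^ 2 < 1) (s : ℝ) :
    HasDerivAt (logTerm x) (logTermDeriv x s) s := by
  have hlin : HasDerivAt (fun s : ℝ => 1 + x * s) x s := by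
    simpa using ((hasDerivAt_id s).const_mul x).const_add 1
  exact hlin.mul ((hasDerivAt_quad x s).log (quad_pos hx s).ne')

lemma hasDerivAt_logTermDeriv {x : ℝ} (hx : x ^ 2 < 1) (s : ℝ) :
    HasDerivAt (logTermDeriv x) (logTermDeriv2 x s) s := by
  have hq := hasDerivAt_quad x s
  have hq0 := (quad_pos hx s).ne'
  have hlin : HasDerivAt (fun s : ℝ => 1 + x * s) x s := by
    simpa using ((hasDerivAt_id s).const_mul x).const_add 1
  have hslope : HasDerivAt (fun s : ℝ => 2 * s + 2 * x) 2 s := by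
    simpa using ((hasDerivAt_id s).const_mul 2).add_const (2 * x)
  refine (((hq.log hq0).const_mul x).add (hlin.mul (hslope.div hq hq0))).congr_deriv ?_
  simp only [logTermDeriv2, Pi.div_apply]
  ring

lemma velocitySum_lt {x a b : ℝ} (hx : x ^ 2 < 1) (ha : -1 < a) (hab : a < b) (hb : b < 1) :
    velocitySum x a < velocitySum x b := by
  unfold velocitySum
  rw [div_lt_div_iff₀ (quad_pos hx a) (quad_pos hx b), ← sub_pos]
  have hprod : a * b < 1 := by nlinarith
  have key : 0 < 2 * ((b - a) * (1 - a * b) * (1 - x ^ 2)) := by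
    have := sub_pos.2 hab
    have := sub_pos.2 hprod
    have := sub_pos.2 hx
    positivity
  refine key.trans_eq ?_
  unfold quad
  ring

/-- The convex combination of second derivatives of `logTerm`, compared with the second derivative
at the averaged parameter, factors through a sum of `velocitySum`s. -/
lemma logTermDeriv2_combination {α β x y z s : ℝ} (hαβ : α + β = 1) (hz : z = α * x + β * y)
    (hx : x ^ 2 < 1) (hy : y ^ 2 < 1) (hz1 : z ^ 2 < 1) :
    α * logTermDeriv2 x s + β * logTermDeriv2 y s - logTermDeriv2 z s
      = 4 * (1 - s ^ 2) * α * β * (x - y) ^ 2 * s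
          / (quad x s * quad y s * quad z s)
          * (velocitySum x s + velocitySum y s + velocitySum z s) := by
  have h1 := (quad_pos hx s).ne'
  have h2 := (quad_pos hy s).ne'
  have h3 := (quad_pos hz1 s).ne'
  unfold logTermDeriv2 velocitySum
  obtain rfl : β = 1 - α := by linarith
  subst hz
  field_simp
  unfold quad
  ring

/-- A function vanishing to second order at `0`, whose second derivative has at most one nonzero
root in an interval around `0`, has at most one nonzero root in that interval. -/
lemma eq_of_roots_of_deriv2 {g g' g'' : ℝ → ℝ} {l r : ℝ}
    (hg : ∀ s, HasDerivAt g (g' s) s) (hg' : ∀ s, HasDerivAt g' (g'' s) s)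
    (hmem : (0 : ℝ) ∈ Ioo l r) (h0 : g 0 = 0) (h0' : g' 0 = 0)
    (huniq : ∀ s ∈ Ioo l r, ∀ u ∈ Ioo l r, s ≠ 0 → u ≠ 0 → g'' s = 0 → g'' u = 0 → s = u)
    {a b : ℝ} (ha : a ∈ Ioo l r) (hb : b ∈ Ioo l r) (ha0 : a ≠ 0) (hb0 : b ≠ 0)
    (hga : g a = 0) (hgb : g b = 0) : a = b := by
  have rolle : ∀ {p p' : ℝ → ℝ}, (∀ s, HasDerivAt p (p' s) s) → ∀ {c d : ℝ}, c < d →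
      p c = 0 → p d = 0 → ∃ e ∈ Ioo c d, p' e = 0 := by
    intro p p' hp c d hcd hc hd
    exact exists_hasDerivAt_eq_zero hcd (fun s _ => (hp s).continuousAt.continuousWithinAt)
      (hc.trans hd.symm) (fun s _ => hp s)
  have main : ∀ {a b : ℝ}, a ∈ Ioo l r → b ∈ Ioo l r → a ≠ 0 → b ≠ 0 → g a = 0 → g b = 0 →
      ¬ a < b := by
    intro a b ha hb ha0 hb0 hga hgb hab
    rcases lt_or_gt_of_ne ha0 with hna | hpa
    · rcases lt_or_gt_of_ne hb0 with hnb | hpb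
      · obtain ⟨c, hc, hgc⟩ := rolle hg hab hga hgb
        obtain ⟨d, hd, hgd⟩ := rolle hg hnb hgb h0
        obtain ⟨e, he, hge⟩ := rolle hg' (hc.2.trans hd.1) hgc hgd
        obtain ⟨k, hk, hgk⟩ := rolle hg' hd.2 hgd h0'
        simp only [mem_Ioo] at *
        have := huniq e ⟨by linarith, by linarith⟩ k ⟨by linarith, by linarith⟩
          (by linarith) (by linarith) hge hgk
        linarith
      · obtain ⟨c, hc, hgc⟩ := rolle hg hna hga h0
        obtain ⟨d, hd, hgd⟩ := rolle hg hpb h0 hgb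
        obtain ⟨e, he, hge⟩ := rolle hg' hc.2 hgc h0'
        obtain ⟨k, hk, hgk⟩ := rolle hg' hd.1 h0' hgd
        simp only [mem_Ioo] at *
        have := huniq e ⟨by linarith, by linarith⟩ k ⟨by linarith, by linarith⟩
          (by linarith) (by linarith) hge hgk
        linarith
    · obtain ⟨c, hc, hgc⟩ := rolle hg hpa h0 hga
      obtain ⟨d, hd, hgd⟩ := rolle hg hab hga hgb
      obtain ⟨e, he, hge⟩ := rolle hg' hc.1 h0' hgc
      obtain ⟨k, hk, hgk⟩ := rolle hg' (hc.2.trans hd.1) hgc hgd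
      simp only [mem_Ioo] at *
      have := huniq e ⟨by linarith, by linarith⟩ k ⟨by linarith, by linarith⟩
        (by linarith) (by linarith) hge hgk
      linarith
  exact le_antisymm (not_lt.1 (main hb ha hb0 ha0 hgb hga)) (not_lt.1 (main ha hb ha0 hb0 hga hgb))

/-- The convex combination of two `logTerm`s minus the `logTerm` at the averaged parameter has at
most one nonzero root in `(-1, 1)`. -/
lemma logTerm_combination_root_unique {α β x y : ℝ} (hα : 0 < α) (hβ : 0 < β)
    (hαβ : α + β = 1) (hx : x ^ 2 < 1) (hy : y ^ 2 < 1) (hxy : x ≠ y) {a b : ℝ}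
    (ha : a ∈ Ioo (-1 : ℝ) 1) (hb : b ∈ Ioo (-1 : ℝ) 1) (ha0 : a ≠ 0) (hb0 : b ≠ 0)
    (hga : α * logTerm x a + β * logTerm y a - logTerm (α * x + β * y) a = 0)
    (hgb : α * logTerm x b + β * logTerm y b - logTerm (α * x + β * y) b = 0) : a = b := by
  obtain ⟨z, hz⟩ : ∃ z, z = α * x + β * y := ⟨_, rfl⟩
  rw [← hz] at hga hgb
  have hz1 : z ^ 2 < 1 := by
    have : z ^ 2 = α * x ^ 2 + β * y ^ 2 - α * β * (x - y) ^ 2 := by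
      obtain rfl : β = 1 - α := by linarith
      rw [hz]
      ring
    have : 0 ≤ α * β * (x - y) ^ 2 := by positivity
    nlinarith
  have velocitySum_eq_zero : ∀ s ∈ Ioo (-1 : ℝ) 1, s ≠ 0 →
      α * logTermDeriv2 x s + β * logTermDeriv2 y s - logTermDeriv2 z s = 0 →
      velocitySum x s + velocitySum y s + velocitySum z s = 0 := by
    intro s hs hs0 h
    rw [logTermDeriv2_combination hαβ hz hx hy hz1] at h
    refine (mul_eq_zero.1 h).resolve_left ?_
    have h1 := (quad_pos hx s).ne'
    have h2 := (quad_pos hy s).ne'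
    have h3 := (quad_pos hz1 s).ne'
    have h4 : 1 - s ^ 2 ≠ 0 := by nlinarith [hs.1, hs.2]
    have h5 := sub_ne_zero.2 hxy
    have := hα.ne'
    have := hβ.ne'
    positivity
  refine eq_of_roots_of_deriv2
    (g := fun s => α * logTerm x s + β * logTerm y s - logTerm z s)
    (fun s => (((hasDerivAt_logTerm hx s).const_mul α).add
      ((hasDerivAt_logTerm hy s).const_mul β)).sub (hasDerivAt_logTerm hz1 s))
    (fun s => (((hasDerivAt_logTermDeriv hx s).const_mul α).add
      ((hasDerivAt_logTermDeriv hy s).const_mul β)).sub (hasDerivAt_logTermDeriv hz1 s))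
    (by norm_num) ?_ ?_ ?_ ha hb ha0 hb0 hga hgb
  · simp [logTerm, quad]
  · simp [logTermDeriv, quad]
    rw [hz]
    ring
  · intro s hs u hu hs0 hu0 h h'
    have e1 := velocitySum_eq_zero s hs hs0 h
    have e2 := velocitySum_eq_zero u hu hu0 h'
    rcases lt_trichotomy s u with hlt | heq | hlt
    · linarith [velocitySum_lt hx hs.1 hlt hu.2, velocitySum_lt hy hs.1 hlt hu.2,
        velocitySum_lt hz1 hs.1 hlt hu.2]
    · exact heq
    · linarith [velocitySum_lt hx hu.1 hlt hs.2, velocitySum_lt hy hu.1 hlt hs.2,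
        velocitySum_lt hz1 hu.1 hlt hs.2]

lemma div_weighted_mean_ne_one {α β p q : ℝ} (hβ : β ≠ 0) (hαβ : α + β = 1)
    (hm : α * p + β * q ≠ 0) (hpq : p ≠ q) : p / (α * p + β * q) ≠ 1 := by
  intro h
  rw [div_eq_one_iff_eq hm] at h
  have : β * (p - q) = 0 := by linear_combination h + p * hαβ
  exact sub_ne_zero.2 hpq ((mul_eq_zero.1 this).resolve_left hβ)

/-- Strict Jensen inequality for the logarithm of two weighted positive numbers relative to
their mean. -/
lemma weighted_log_div_mean_neg {α β p q : ℝ} (hα : 0 < α) (hβ : 0 < β) (hαβ : α + β = 1)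
    (hp : 0 < p) (hq : 0 < q) (hpq : p ≠ q) :
    α * log (p / (α * p + β * q)) + β * log (q / (α * p + β * q)) < 0 := by
  have hm : 0 < α * p + β * q := by positivity
  have hpm : p / (α * p + β * q) ≠ 1 := div_weighted_mean_ne_one hβ.ne' hαβ hm.ne' hpq
  have h1 := mul_lt_mul_of_pos_left (log_lt_sub_one_of_pos (div_pos hp hm) hpm) hα
  have h2 := mul_le_mul_of_nonneg_left (log_le_sub_one_of_pos (div_pos hq hm)) hβ.le
  have h3 : α * (p / (α * p + β * q) - 1) + β * (q / (α * p + β * q) - 1) = 0 := by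
    field_simp
    linear_combination (-(α * p + β * q)) * hαβ
  linarith

/-- Strict positivity of the weighted relative entropy of two distinct positive numbers with
respect to their mean. -/
lemma weighted_mul_log_div_mean_pos {α β p q : ℝ} (hα : 0 < α) (hβ : 0 < β)
    (hαβ : α + β = 1) (hp : 0 < p) (hq : 0 < q) (hpq : p ≠ q) :
    0 < α * (p * log (p / (α * p + β * q))) + β * (q * log (q / (α * p + β * q))) := by
  have hm : 0 < α * p + β * q := by positivity
  have hpm : p / (α * p + β * q) ≠ 1 := div_weighted_mean_ne_one hβ.ne' hαβ hm.ne' hpq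
  have hlog : ∀ u, u * log (u / (α * p + β * q)) = -(u * log ((α * p + β * q) / u)) := by
    intro u
    rw [← inv_div, log_inv, mul_neg]
  have hsub : ∀ u : ℝ, 0 < u →
      u * ((α * p + β * q) / u - 1) = α * p + β * q - u := by
    intro u hu
    field_simp
  have h1 := mul_lt_mul_of_pos_left (mul_lt_mul_of_pos_left
    (log_lt_sub_one_of_pos (div_pos hm hp) (by rwa [← inv_div, ne_eq, inv_eq_one])) hp) hα
  have h2 := mul_le_mul_of_nonneg_left (mul_le_mul_of_nonneg_left
    (log_le_sub_one_of_pos (div_pos hm hq)) hq.le) hβ.le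
  rw [hsub p hp] at h1
  rw [hsub q hq] at h2
  rw [hlog, hlog]
  have h3 : α * (α * p + β * q - p) + β * (α * p + β * q - q) = 0 := by
    linear_combination (α * p + β * q) * hαβ
  linarith

/-- Nonzero roots of the normalized function lie outside `[-1, 1]`. -/
lemma one_lt_sq_of_root {α β x y : ℝ} (hα : 0 < α) (hβ : 0 < β) (hαβ : α + β = 1)
    (hx : x ^ 2 < 1) (hy : y ^ 2 < 1) (hxy : x ≠ y) {t : ℝ} (ht0 : t ≠ 0)
    (ht : α * (t + x) * log (quad x t / (α * quad x t + β * quad y t))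
      + β * (t + y) * log (quad y t / (α * quad x t + β * quad y t)) = 0) : 1 < t ^ 2 := by
  by_contra! hle
  have hne : quad x t ≠ quad y t := by
    intro h
    have : 2 * t * (x - y) = 0 := by unfold quad at h; linarith
    exact mul_ne_zero (mul_ne_zero two_ne_zero ht0) (sub_ne_zero.2 hxy) this
  have hneg := weighted_log_div_mean_neg hα hβ hαβ (quad_pos hx t) (quad_pos hy t) hne
  have hpos := weighted_mul_log_div_mean_pos hα hβ hαβ (quad_pos hx t) (quad_pos hy t) hne
  set A := log (quad x t / (α * quad x t + β * quad y t))
  set B := log (quad y t / (α * quad x t + β * quad y t))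
  have hid : 2 * t * (α * (t + x) * A + β * (t + y) * B)
      = (α * (quad x t * A) + β * (quad y t * B)) - (1 - t ^ 2) * (α * A + β * B) := by
    unfold quad
    ring
  rw [ht, mul_zero] at hid
  linarith [mul_nonneg (sub_nonneg.2 hle) (neg_nonneg.2 hneg.le)]

/-- A nonzero root of the normalized function gives the reciprocal root of the combination of
`logTerm`s. -/
lemma logTerm_combination_inv_eq_zero {α β x y : ℝ} (hαβ : α + β = 1)
    (hα : 0 < α) (hβ : 0 < β) (hx : x ^ 2 < 1) (hy : y ^ 2 < 1) {t : ℝ} (ht0 : t ≠ 0)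
    (ht : α * (t + x) * log (quad x t / (α * quad x t + β * quad y t))
      + β * (t + y) * log (quad y t / (α * quad x t + β * quad y t)) = 0) :
    α * logTerm x t⁻¹ + β * logTerm y t⁻¹ - logTerm (α * x + β * y) t⁻¹ = 0 := by
  have hinv : ∀ w, quad w t⁻¹ = quad w t / t ^ 2 := by
    intro w
    unfold quad
    field_simp
    ring
  have hmean : quad (α * x + β * y) t = α * quad x t + β * quad y t := by
    unfold quad
    linear_combination (-(t ^ 2 + 1)) * hαβ
  have hqx := quad_pos hx t
  have hqy := quad_pos hy t
  have hm : 0 < α * quad x t + β * quad y t := by positivity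
  have ht2 : t ^ 2 ≠ 0 := pow_ne_zero 2 ht0
  rw [log_div hqx.ne' hm.ne', log_div hqy.ne' hm.ne'] at ht
  unfold logTerm
  rw [hinv, hinv, hinv, hmean, log_div hqx.ne' ht2, log_div hqy.ne' ht2, log_div hm.ne' ht2]
  obtain rfl : β = 1 - α := by linarith
  field_simp
  linear_combination ht

/-- The normalized function has at most one nonzero root. -/
lemma normalized_root_unique {α β x y : ℝ} (hα : 0 < α) (hβ : 0 < β) (hαβ : α + β = 1)
    (hx : x ^ 2 < 1) (hy : y ^ 2 < 1) (hxy : x ≠ y) {t u : ℝ} (ht0 : t ≠ 0) (hu0 : u ≠ 0)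
    (ht : α * (t + x) * log (quad x t / (α * quad x t + β * quad y t))
      + β * (t + y) * log (quad y t / (α * quad x t + β * quad y t)) = 0)
    (hu : α * (u + x) * log (quad x u / (α * quad x u + β * quad y u))
      + β * (u + y) * log (quad y u / (α * quad x u + β * quad y u)) = 0) : t = u := by
  have mem : ∀ {v : ℝ}, 1 < v ^ 2 → v⁻¹ ∈ Ioo (-1 : ℝ) 1 := by
    intro v hv
    rw [mem_Ioo, ← abs_lt, abs_inv]
    exact inv_lt_one_of_one_lt₀ ((one_lt_sq_iff_one_lt_abs v).1 hv)
  exact inv_injective <| logTerm_combination_root_unique hα hβ hαβ hx hy hxy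
    (mem (one_lt_sq_of_root hα hβ hαβ hx hy hxy ht0 ht))
    (mem (one_lt_sq_of_root hα hβ hαβ hx hy hxy hu0 hu))
    (inv_ne_zero ht0) (inv_ne_zero hu0)
    (logTerm_combination_inv_eq_zero hαβ hα hβ hx hy ht0 ht)
    (logTerm_combination_inv_eq_zero hαβ hα hβ hx hy hu0 hu)

/-- A set with at most one element different from a given point has at most two elements. -/
lemma encard_le_two_of_unique_ne {X : Type*} {S : Set X} (c : X)
    (h : ∀ t ∈ S, ∀ u ∈ S, t ≠ c → u ≠ c → t = u) : S.encard ≤ 2 := by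
  have hsub : (S \ {c}).Subsingleton := fun t ht u hu => h t ht.1 u hu.1 ht.2 hu.2
  calc S.encard ≤ (S \ {c}).encard + ({c} : Set X).encard :=
        encard_le_encard_sdiff_add_encard S {c}
    _ ≤ 1 + 1 := add_le_add (encard_le_one_iff_subsingleton.2 hsub) (encard_singleton c).le
    _ = 2 := one_add_one_eq_two

end QubitRoots

open QubitRoots

/-- Theorem 1 of the paper: under the constraints `ξ_r^2 < η_r` (`r = 1,2`),
`0 < α₁, α₂ < 1`, `α₁ + α₂ = 1`, and `(ξ₁, η₁) ≠ (ξ₂, η₂)`, the function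
`f(t) = Σ_r α_r Q_r'(t) log (Q_r(t)/(α₁ Q₁(t)+α₂ Q₂(t)))`, with
`Q_r(t) = t² + 2 t ξ_r + η_r`, has at most two real roots. -/
theorem stmt_18 (α₁ α₂ ξ₁ ξ₂ η₁ η₂ : ℝ)
    (hα₁ : α₁ ∈ Set.Ioo (0 : ℝ) 1) (hα₂ : α₂ ∈ Set.Ioo (0 : ℝ) 1) (hsum : α₁ + α₂ = 1)
    (h₁ : ξ₁ ^ 2 < η₁) (h₂ : ξ₂ ^ 2 < η₂)
    (hne : (ξ₁, η₁) ≠ (ξ₂, η₂))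
    (Q₁ Q₂ f : ℝ → ℝ)
    (hQ₁ : ∀ t, Q₁ t = t ^ 2 + 2 * t * ξ₁ + η₁)
    (hQ₂ : ∀ t, Q₂ t = t ^ 2 + 2 * t * ξ₂ + η₂)
    (hf : ∀ t, f t = α₁ * (2 * (t + ξ₁)) * Real.log (Q₁ t / (α₁ * Q₁ t + α₂ * Q₂ t))
        + α₂ * (2 * (t + ξ₂)) * Real.log (Q₂ t / (α₁ * Q₁ t + α₂ * Q₂ t))) :
    {t : ℝ | f t = 0}.encard ≤ 2 := by
  have hQ₁pos : ∀ t, 0 < Q₁ t := fun t => by rw [hQ₁]; nlinarith [sq_nonneg (t + ξ₁)]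
  have hQ₂pos : ∀ t, 0 < Q₂ t := fun t => by rw [hQ₂]; nlinarith [sq_nonneg (t + ξ₂)]
  by_cases hξ : ξ₁ = ξ₂
  · subst hξ
    refine encard_le_two_of_unique_ne (-ξ₁) ?_
    have only_root : ∀ t, f t = 0 → t = -ξ₁ := by
      intro t ht
      have hQne : Q₁ t ≠ Q₂ t := by
        intro h
        rw [hQ₁, hQ₂] at h
        exact hne (by rw [add_left_cancel h])
      have hneg := weighted_log_div_mean_neg hα₁.1 hα₂.1 hsum (hQ₁pos t) (hQ₂pos t) hQne
      have hfac : 2 * (t + ξ₁) * (α₁ * log (Q₁ t / (α₁ * Q₁ t + α₂ * Q₂ t))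
          + α₂ * log (Q₂ t / (α₁ * Q₁ t + α₂ * Q₂ t))) = 0 := by
        rw [← ht, hf]
        ring
      have := (mul_eq_zero.1 hfac).resolve_right hneg.ne
      linarith
    exact fun t ht _ _ hne' _ => absurd (only_root t ht) hne'
  · obtain ⟨c, hc⟩ : ∃ c, c = (η₂ - η₁) / (2 * (ξ₁ - ξ₂)) := ⟨_, rfl⟩
    have hδ := sub_ne_zero.2 hξ
    have hQc : Q₁ c = Q₂ c := by
      rw [hQ₁, hQ₂]
      have : c * (2 * (ξ₁ - ξ₂)) = η₂ - η₁ := by rw [hc]; field_simp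
      linarith
    obtain ⟨ρ, hρ⟩ : ∃ ρ, ρ = √(Q₁ c) := ⟨_, rfl⟩
    have hρpos : 0 < ρ := hρ ▸ sqrt_pos.2 (hQ₁pos c)
    have hρ₁ : ρ ^ 2 = c ^ 2 + 2 * c * ξ₁ + η₁ := by
      rw [hρ, sq_sqrt (hQ₁pos c).le, hQ₁]
    have hρ₂ : ρ ^ 2 = c ^ 2 + 2 * c * ξ₂ + η₂ := by
      rw [hρ, sq_sqrt (hQ₁pos c).le, hQc, hQ₂]
    have hx₁ : ((ξ₁ + c) / ρ) ^ 2 < 1 := by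
      rw [div_pow, div_lt_one (by positivity)]
      nlinarith
    have hx₂ : ((ξ₂ + c) / ρ) ^ 2 < 1 := by
      rw [div_pow, div_lt_one (by positivity)]
      nlinarith
    have hx : (ξ₁ + c) / ρ ≠ (ξ₂ + c) / ρ := by
      intro h
      rw [div_left_inj' hρpos.ne'] at h
      exact hξ (add_right_cancel h)
    have hquad₁ : ∀ t, Q₁ t = ρ ^ 2 * quad ((ξ₁ + c) / ρ) ((t - c) / ρ) := by
      intro t
      unfold quad
      rw [hQ₁]
      field_simp
      linear_combination -hρ₁
    have hquad₂ : ∀ t, Q₂ t = ρ ^ 2 * quad ((ξ₂ + c) / ρ) ((t - c) / ρ) := by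
      intro t
      unfold quad
      rw [hQ₂]
      field_simp
      linear_combination -hρ₂
    have normalize : ∀ t, f t = 0 →
        α₁ * ((t - c) / ρ + (ξ₁ + c) / ρ) * log (quad ((ξ₁ + c) / ρ) ((t - c) / ρ)
          / (α₁ * quad ((ξ₁ + c) / ρ) ((t - c) / ρ) + α₂ * quad ((ξ₂ + c) / ρ) ((t - c) / ρ)))
        + α₂ * ((t - c) / ρ + (ξ₂ + c) / ρ) * log (quad ((ξ₂ + c) / ρ) ((t - c) / ρ)
          / (α₁ * quad ((ξ₁ + c) / ρ) ((t - c) / ρ)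
            + α₂ * quad ((ξ₂ + c) / ρ) ((t - c) / ρ))) = 0 := by
      intro t ht
      have hρ2 : ρ ^ 2 ≠ 0 := by positivity
      rw [hf, hquad₁, hquad₂, mul_left_comm α₁ (ρ ^ 2), mul_left_comm α₂ (ρ ^ 2), ← mul_add,
        mul_div_mul_left _ _ hρ2, mul_div_mul_left _ _ hρ2] at ht
      have e₁ : (t - c) / ρ + (ξ₁ + c) / ρ = (t + ξ₁) / ρ := by ring
      have e₂ : (t - c) / ρ + (ξ₂ + c) / ρ = (t + ξ₂) / ρ := by ring
      rw [e₁, e₂]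
      linear_combination ht / (2 * ρ)
    refine encard_le_two_of_unique_ne c fun t ht u hu htc huc => ?_
    have h := normalized_root_unique hα₁.1 hα₂.1 hsum hx₁ hx₂ hx
      (div_ne_zero (sub_ne_zero.2 htc) hρpos.ne') (div_ne_zero (sub_ne_zero.2 huc) hρpos.ne')
      (normalize t ht) (normalize u hu)
    rw [div_left_inj' hρpos.ne'] at h
    exact sub_left_injective h
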